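/- For all integers d, n ≥ 1 there exists a constant C_{d,n} > 0, depending only on d and n, such that for every prime p, every polynomial Q ∈ ℤ[X₁,…,Xₙ] of degree at most d, every integer α ≥ 1 and every integer a, one has max(1, H_{p^{-α}Q}) · p^{-nα} · N_{a,α} ≤ C_{d,n}, where N_{a,α} is the number of x ∈ {0,…,p^α−1}^n with Q(x) ≡ a (mod p^α). -/

import Mathlib

/-- The iterated partial derivative `∂^β P` of a polynomial in `n` variables. -/
noncomputable def mvDeriv {p : ℕ} [Fact p.Prime] {n : ℕ} (β : Fin n → ℕ)
    (P : MvPolynomial (Fin n) ℚ_[p]) : MvPolynomial (Fin n) ℚ_[p] :=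
  (List.finRange n).foldl (fun Q i => (⇑(MvPolynomial.pderiv i))^[β i] Q) P

/-- `H_P(z) = max_{1 ≤ |β| ≤ deg P} |∂^β P(z)/β!|^{1/|β|}` (empty max = 0). -/
noncomputable def HfunMv {p : ℕ} [Fact p.Prime] {n : ℕ} (P : MvPolynomial (Fin n) ℚ_[p])
    (z : Fin n → ℤ_[p]) : NNReal :=
  Finset.univ.sup fun b : Fin n → Fin (P.totalDegree + 1) =>
    if 1 ≤ ∑ i, (b i : ℕ) ∧ ∑ i, (b i : ℕ) ≤ P.totalDegree then
      ‖MvPolynomial.eval (fun i => ((z i : ℚ_[p])))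
          (mvDeriv (fun i => (b i : ℕ)) P) /
          ((∏ i, Nat.factorial (b i) : ℕ) : ℚ_[p])‖₊ ^ ((1 : ℝ) / ((∑ i, (b i : ℕ) : ℕ) : ℝ))
    else 0

/-- `J_P(z) = max_{2 ≤ |β| ≤ deg P} |∂^β P(z)/β!|^{1/|β|}` (empty max = 0). -/
noncomputable def JfunMv {p : ℕ} [Fact p.Prime] {n : ℕ} (P : MvPolynomial (Fin n) ℚ_[p])
    (z : Fin n → ℤ_[p]) : NNReal :=
  Finset.univ.sup fun b : Fin n → Fin (P.totalDegree + 1) =>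
    if 2 ≤ ∑ i, (b i : ℕ) ∧ ∑ i, (b i : ℕ) ≤ P.totalDegree then
      ‖MvPolynomial.eval (fun i => ((z i : ℚ_[p])))
          (mvDeriv (fun i => (b i : ℕ)) P) /
          ((∏ i, Nat.factorial (b i) : ℕ) : ℚ_[p])‖₊ ^ ((1 : ℝ) / ((∑ i, (b i : ℕ) : ℕ) : ℝ))
    else 0

/-- `H_P = inf_{z ∈ ℤ_p^n} H_P(z)`. -/
noncomputable def HinfMv {p : ℕ} [Fact p.Prime] {n : ℕ} (P : MvPolynomial (Fin n) ℚ_[p]) :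
    NNReal :=
  ⨅ z : Fin n → ℤ_[p], HfunMv P z

/-- The polynomial `p^{-α} Q` regarded as an element of `ℚ_p[X₁,…,Xₙ]`. -/
noncomputable def mvScaled (p : ℕ) [Fact p.Prime] {n : ℕ} (α : ℕ)
    (Q : MvPolynomial (Fin n) ℤ) : MvPolynomial (Fin n) ℚ_[p] :=
  MvPolynomial.C (((p : ℚ_[p]) ^ α)⁻¹) * MvPolynomial.map (Int.castRingHom ℚ_[p]) Q

open Polynomial

lemma norm_coeff_prod_X_add_C_le {L : Type*} [NormedField L] [IsUltrametricDist L] {K : ℝ}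
    (hK : 0 < K) (s : Multiset L) (hs : ∀ a ∈ s, 1 < K * ‖a‖) (j : ℕ) :
    ‖(s.map fun a => X + C a).prod.coeff j‖ ≤ K ^ j * ‖s.prod‖ ∧
      (1 ≤ j → ‖(s.map fun a => X + C a).prod.coeff j‖ < K ^ j * ‖s.prod‖) := by
  induction s using Multiset.induction_on generalizing j with
  | empty =>
    rcases j with _ | j
    · simp
    · simp [coeff_one, hK]
      positivity
  | cons a s ih =>
    have ha := hs a (Multiset.mem_cons_self a s)
    have ih' := ih fun b hb => hs b (Multiset.mem_cons_of_mem hb)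
    have ha0 : 0 < ‖a‖ := by
      by_contra h
      have : ‖a‖ = 0 := le_antisymm (not_lt.mp h) (norm_nonneg a)
      rw [this] at ha
      norm_num at ha
    have hs0 : 0 < ‖s.prod‖ := by
      rw [norm_pos_iff]
      intro h
      have h2 := hs 0 (Multiset.mem_cons_of_mem (Multiset.prod_eq_zero_iff.mp h))
      norm_num at h2
    rcases j with _ | j
    · have h0 := (ih' 0).1
      simp only [Multiset.map_cons, Multiset.prod_cons, mul_coeff_zero, norm_mul] at *
      simp only [coeff_add, coeff_X_zero, coeff_C_zero, zero_add, pow_zero, one_mul] at *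
      exact ⟨by gcongr, by simp⟩
    · suffices h : ‖((a ::ₘ s).map fun a => X + C a).prod.coeff (j + 1)‖ <
          K ^ (j + 1) * ‖(a ::ₘ s).prod‖ from ⟨h.le, fun _ => h⟩
      simp only [Multiset.map_cons, Multiset.prod_cons, add_mul, coeff_add, coeff_X_mul,
        coeff_C_mul, norm_mul]
      refine (IsUltrametricDist.norm_add_le_max _ _).trans_lt (max_lt ?_ ?_)
      · refine (ih' j).1.trans_lt ?_
        calc K ^ j * ‖s.prod‖ = K ^ j * ‖s.prod‖ * 1 := by ring
          _ < K ^ j * ‖s.prod‖ * (K * ‖a‖) := by gcongr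
          _ = _ := by ring
      · rw [norm_mul]
        calc ‖a‖ * _ < ‖a‖ * (K ^ (j + 1) * ‖s.prod‖) := by
              gcongr
              exact (ih' (j + 1)).2 (by omega)
          _ = _ := by ring

/-- A point at which some Taylor coefficient dominates the value is close to a root. -/
lemma exists_mem_roots_norm_sub_le {L : Type*} [NormedField L] [IsUltrametricDist L]
    [IsAlgClosed L] (h : L[X]) (t : L) {j : ℕ} (hj : 1 ≤ j) {K : ℝ} (hK : 0 < K)
    (h0 : h ≠ 0) (hc : ‖h.eval t‖ * K ^ j ≤ ‖(taylor t h).coeff j‖) :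
    ∃ ρ ∈ h.roots, K * ‖t - ρ‖ ≤ 1 := by
  by_contra! hcon
  have hsplit := (IsAlgClosed.splits h).eq_prod_roots
  have hs : ∀ a ∈ h.roots.map (fun ρ => t - ρ), 1 < K * ‖a‖ := by
    intro a ha
    obtain ⟨ρ, hρ, rfl⟩ := Multiset.mem_map.mp ha
    exact hcon ρ hρ
  have key := (norm_coeff_prod_X_add_C_le hK _ hs j).2 hj
  have htay : taylor t h = C h.leadingCoeff *
      ((h.roots.map (fun ρ => t - ρ)).map fun a => X + C a).prod := by
    conv_lhs => rw [hsplit]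
    rw [taylor_mul, taylor_C, ← taylorAlgHom_apply, map_multiset_prod, Multiset.map_map,
      Multiset.map_map]
    congr 2
    refine Multiset.map_congr rfl fun ρ _ => ?_
    simp
    ring
  have hev : h.eval t = h.leadingCoeff * (h.roots.map (fun ρ => t - ρ)).prod :=
    (IsAlgClosed.splits h).eval_eq_prod_roots t
  rw [htay, hev, coeff_C_mul, norm_mul, norm_mul] at hc
  have hl : 0 < ‖h.leadingCoeff‖ := by simpa using h0
  nlinarith

lemma one_le_norm_intCast_mul_abs (p : ℕ) [Fact p.Prime] {m : ℤ} (hm : m ≠ 0) :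
    1 ≤ ‖(m : ℚ_[p])‖ * |(m : ℝ)| := by
  have hp : 0 < (p : ℝ) := by exact_mod_cast (Fact.out : p.Prime).pos
  have hd : (p : ℤ) ^ (padicValInt p m) ∣ m := padicValInt_dvd m
  have hle : (p : ℝ) ^ (padicValInt p m) ≤ |(m : ℝ)| := by
    have := Int.le_of_dvd (abs_pos.mpr hm) ((dvd_abs _ _).mpr hd)
    exact_mod_cast this
  rw [Padic.norm_eq_zpow_neg_valuation (by exact_mod_cast hm), Padic.valuation_intCast, zpow_neg,
    zpow_natCast]
  rw [inv_mul_eq_div, le_div_iff₀ (by positivity)]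
  simpa using hle

/-- Naturals below `q` at mutual `p`-adic distance at most `1 / K` number at most `q / K + 1`. -/
lemma card_le_of_norm_sub_le (p : ℕ) [Fact p.Prime] (q : ℕ) {K : ℝ} (hK : 0 < K)
    (T : Finset ℕ) (hT : T ⊆ Finset.range q)
    (hd : ∀ s ∈ T, ∀ t ∈ T, K * ‖((s : ℚ_[p]) - t)‖ ≤ 1) :
    (T.card : ℝ) ≤ q / K + 1 := by
  set l := ⌈K⌉₊ with hl
  have hl0 : 0 < l := Nat.ceil_pos.mpr hK
  have hinj : Set.InjOn (fun t => t / l) (T : Set ℕ) := by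
    intro s hs t ht hst
    by_contra hne
    have hm : (s : ℤ) - t ≠ 0 := sub_ne_zero.mpr (by exact_mod_cast hne)
    have h1 := one_le_norm_intCast_mul_abs p hm
    have h2 := hd s hs t ht
    have h3 : |(s : ℤ) - t| ≤ l - 1 := by
      have e : s / l = t / l := hst
      have a1 := Nat.div_add_mod s l
      have a2 := Nat.div_add_mod t l
      have b1 := Nat.mod_lt s hl0
      have b2 := Nat.mod_lt t hl0
      rw [e] at a1
      rw [abs_le]
      constructor <;> omega
    have h4 : |(((s : ℤ) - t : ℤ) : ℝ)| ≤ l - 1 := by exact_mod_cast h3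
    have h5 : (l : ℝ) < K + 1 := Nat.ceil_lt_add_one hK.le
    push_cast at h1 h4
    have hn : 0 < ‖((s : ℚ_[p]) - t)‖ := by
      rw [norm_pos_iff, sub_ne_zero]
      exact_mod_cast hne
    nlinarith
  have hcard : T.card ≤ q / l + 1 := by
    rw [← Finset.card_range (q / l + 1)]
    refine Finset.card_le_card_of_injOn (fun t => t / l) (fun t ht => ?_) hinj
    have := Finset.mem_range.mp (hT ht)
    simp only [Finset.coe_range, Set.mem_Iio]
    exact Nat.lt_succ_of_le (Nat.div_le_div_right this.le)
  calc (T.card : ℝ) ≤ ((q / l : ℕ) : ℝ) + 1 := by exact_mod_cast hcard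
    _ ≤ q / l + 1 := by gcongr; exact Nat.cast_div_le
    _ ≤ q / K + 1 := by gcongr; exact Nat.le_ceil K

/-- One-variable sublevel estimate. -/
lemma card_sublevel_le (p : ℕ) [Fact p.Prime] (q d : ℕ) {K : ℝ} (hK : 0 < K) (G : ℤ[X])
    (hG : G.natDegree ≤ d) (a : ℤ) (T : Finset ℕ) (hT : T ⊆ Finset.range q)
    (hv : ∀ t ∈ T, ‖((G.eval (t : ℤ) - a : ℤ) : ℚ_[p])‖ * q ≤ 1)
    (hc : ∀ t ∈ T, ∃ j, 1 ≤ j ∧ K ^ j ≤ ‖(((taylor (t : ℤ) G).coeff j : ℤ) : ℚ_[p])‖ * q) :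
    (T.card : ℝ) ≤ d * (2 * q / K) := by
  classical
  rcases T.eq_empty_or_nonempty with rfl | ⟨t₀, ht₀⟩
  · simp; positivity
  have hq : 1 ≤ (q : ℝ) := by
    have := Finset.mem_range.mp (hT ht₀)
    exact_mod_cast (by omega : 1 ≤ q)
  have hKq : K ≤ q := by
    obtain ⟨j, hj, h⟩ := hc t₀ ht₀
    rcases le_total K 1 with h1 | h1
    · linarith
    · calc K ≤ K ^ j := le_self_pow₀ h1 (by omega)
        _ ≤ _ := h
        _ ≤ 1 * q := by gcongr; exact Padic.norm_int_le_one _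
        _ = q := one_mul _
  let φ : ℤ →+* PadicAlgCl p := Int.castRingHom _
  have hnorm : ∀ m : ℤ, ‖φ m‖ = ‖(m : ℚ_[p])‖ := by
    intro m
    rw [← PadicAlgCl.norm_extends]
    simp [φ]
  set h : (PadicAlgCl p)[X] := (G - C a).map φ with hh
  have hroot : ∀ t ∈ T, ∃ ρ ∈ h.roots.toFinset, K * ‖(t : PadicAlgCl p) - ρ‖ ≤ 1 := by
    intro t ht
    obtain ⟨j, hj, hcj⟩ := hc t ht
    have hco : (taylor (t : PadicAlgCl p) h).coeff j = φ ((taylor (t : ℤ) G).coeff j) := by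
      have : (t : PadicAlgCl p) = φ (t : ℤ) := by simp [φ]
      rw [this, hh, ← map_taylor, coeff_map, map_sub, taylor_C, coeff_sub, coeff_C,
        if_neg (by omega), sub_zero]
    have hev : h.eval (t : PadicAlgCl p) = φ (G.eval (t : ℤ) - a) := by
      have : (t : PadicAlgCl p) = φ (t : ℤ) := by simp [φ]
      rw [this, hh, eval_map, eval₂_at_apply]
      simp
    have h0 : h ≠ 0 := by
      intro h0
      rw [h0] at hco
      have h1 := hnorm ((taylor (t : ℤ) G).coeff j)
      rw [← hco] at h1
      simp only [map_zero, coeff_zero, norm_zero] at h1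
      rw [← h1, zero_mul] at hcj
      have : 0 < K ^ j := by positivity
      linarith
    obtain ⟨ρ, hρ, hle⟩ := exists_mem_roots_norm_sub_le h (t : PadicAlgCl p) hj hK h0 (by
      rw [hco, hev, hnorm, hnorm]
      have h1 := hv t ht
      calc _ ≤ ‖((G.eval (t : ℤ) - a : ℤ) : ℚ_[p])‖ *
            (‖(((taylor (t : ℤ) G).coeff j : ℤ) : ℚ_[p])‖ * q) := by gcongr
        _ = (‖((G.eval (t : ℤ) - a : ℤ) : ℚ_[p])‖ * q) *
            ‖(((taylor (t : ℤ) G).coeff j : ℤ) : ℚ_[p])‖ := by ring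
        _ ≤ 1 * _ := by gcongr
        _ = _ := one_mul _)
    exact ⟨ρ, Multiset.mem_toFinset.mpr hρ, hle⟩
  have hsub : T ⊆ h.roots.toFinset.biUnion fun ρ =>
      T.filter fun t : ℕ => K * ‖(t : PadicAlgCl p) - ρ‖ ≤ 1 := by
    intro t ht
    obtain ⟨ρ, hρ, hle⟩ := hroot t ht
    exact Finset.mem_biUnion.mpr ⟨ρ, hρ, Finset.mem_filter.mpr ⟨ht, hle⟩⟩
  have hball : ∀ ρ : PadicAlgCl p,
      ((T.filter fun t : ℕ => K * ‖(t : PadicAlgCl p) - ρ‖ ≤ 1).card : ℝ) ≤ 2 * q / K := by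
    intro ρ
    refine (card_le_of_norm_sub_le p q hK _ ((Finset.filter_subset _ _).trans hT) ?_).trans ?_
    · intro s hs t ht
      have hs := (Finset.mem_filter.mp hs).2
      have ht := (Finset.mem_filter.mp ht).2
      have e : ‖((s : ℚ_[p]) - t)‖ = dist (s : PadicAlgCl p) t := by
        have := hnorm ((s : ℤ) - t)
        simp only [φ] at this
        push_cast at this
        rw [← this, dist_eq_norm, map_sub, map_natCast, map_natCast]
      rw [e]
      rcases le_max_iff.mp (IsUltrametricDist.dist_triangle_max (s : PadicAlgCl p) ρ t)
        with h1 | h1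
      · rw [dist_eq_norm _ ρ] at h1
        exact le_trans (by gcongr) hs
      · rw [dist_comm ρ, dist_eq_norm _ ρ] at h1
        exact le_trans (by gcongr) ht
    · have : 1 ≤ q / K := (one_le_div hK).mpr hKq
      have e : 2 * q / K = q / K + q / K := by ring
      linarith
  have hroots : h.roots.toFinset.card ≤ d := by
    refine (Multiset.toFinset_card_le _).trans ((card_roots' h).trans (natDegree_map_le.trans ?_))
    exact (natDegree_sub_C).trans_le hG
  calc (T.card : ℝ) ≤ ((h.roots.toFinset.biUnion fun ρ =>
        T.filter fun t : ℕ => K * ‖(t : PadicAlgCl p) - ρ‖ ≤ 1).card : ℝ) := by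
        exact_mod_cast Finset.card_le_card hsub
    _ ≤ ∑ ρ ∈ h.roots.toFinset,
        ((T.filter fun t : ℕ => K * ‖(t : PadicAlgCl p) - ρ‖ ≤ 1).card : ℝ) := by
        exact_mod_cast Finset.card_biUnion_le
    _ ≤ ∑ ρ ∈ h.roots.toFinset, 2 * q / K := Finset.sum_le_sum fun ρ _ => hball ρ
    _ = h.roots.toFinset.card * (2 * q / K) := by rw [Finset.sum_const, nsmul_eq_mul]
    _ ≤ d * (2 * q / K) := by gcongr
/-- The translate `P(X + x)`. -/
noncomputable def mvShift {σ R : Type*} [CommRing R] (x : σ → R) :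
    MvPolynomial σ R →ₐ[R] MvPolynomial σ R :=
  MvPolynomial.aeval fun i => MvPolynomial.X i + MvPolynomial.C (x i)

/-- The restriction `P(x + T v)` to the line through `x` with direction `v`. -/
noncomputable def mvLine {σ R : Type*} [CommRing R] (x v : σ → R) :
    MvPolynomial σ R →ₐ[R] R[X] :=
  MvPolynomial.aeval fun i => C (x i) + C (v i) * X

lemma mvLine_eq_mvShift {σ R : Type*} [CommRing R] (x v : σ → R) (P : MvPolynomial σ R) :
    mvLine x v P = MvPolynomial.aeval (fun i => C (v i) * X) (mvShift x P) := by
  have : mvLine x v = (MvPolynomial.aeval (fun i => C (v i) * X)).comp (mvShift x) := by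
    ext1 i
    simp [mvLine, mvShift, add_comm]
  rw [this]
  rfl

lemma coeff_mvLine {σ R : Type*} [Fintype σ] [CommRing R] (x v : σ → R) (P : MvPolynomial σ R)
    (j : ℕ) : (mvLine x v P).coeff j = ∑ m ∈ (mvShift x P).support,
      if ∑ i, m i = j then (mvShift x P).coeff m * ∏ i, v i ^ m i else 0 := by
  rw [mvLine_eq_mvShift, MvPolynomial.aeval_eq_eval₂Hom, MvPolynomial.coe_eval₂Hom,
    MvPolynomial.eval₂_eq', finsetSum_coeff]
  refine Finset.sum_congr rfl fun m _ => ?_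
  simp_rw [mul_pow, Finset.prod_mul_distrib, ← C_pow, Finset.prod_pow_eq_pow_sum, ← map_prod]
  rw [← C_eq_algebraMap, coeff_C_mul, coeff_C_mul, coeff_X_pow]
  simp [eq_comm]

lemma natDegree_mvLine_le {σ R : Type*} [CommRing R] (x v : σ → R) (P : MvPolynomial σ R)
    {d : ℕ} (hP : P.totalDegree ≤ d) : (mvLine x v P).natDegree ≤ d := by
  have := MvPolynomial.aeval_natDegree_le P hP (fun i => C (x i) + C (v i) * X) (n := 1)
    (fun i => by rw [add_comm]; exact natDegree_linear_le)
  simpa [mvLine] using this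

lemma taylor_mvLine {σ R : Type*} [CommRing R] (x v : σ → R) (t : R) (P : MvPolynomial σ R) :
    taylor t (mvLine x v P) = mvLine (fun i => x i + t * v i) v P := by
  have : (taylorAlgHom t).comp (mvLine x v) = mvLine (fun i => x i + t * v i) v := by
    ext1 i
    simp [mvLine]
    ring
  rw [← this]
  rfl

lemma eval_mvLine {σ R : Type*} [CommRing R] (x v : σ → R) (t : R) (P : MvPolynomial σ R) :
    (mvLine x v P).eval t = MvPolynomial.eval (fun i => x i + t * v i) P := by
  have : (Polynomial.aeval t).comp (mvLine x v) =
      MvPolynomial.aeval (fun i => x i + t * v i) := by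
    ext1 i
    simp [mvLine]
    ring
  have h := DFunLike.congr_fun this P
  simpa [Polynomial.coe_aeval_eq_eval, MvPolynomial.aeval_eq_eval] using h

/-- The Vandermonde matrix of `0, …, d`. -/
def vander (d : ℕ) : Matrix (Fin (d + 1)) (Fin (d + 1)) ℤ :=
  Matrix.vandermonde fun u => ((u : ℕ) : ℤ)

lemma det_vander_ne_zero (d : ℕ) : (vander d).det ≠ 0 := by
  rw [vander, Matrix.det_vandermonde_ne_zero_iff]
  intro u w h
  exact Fin.ext (Int.natCast_inj.mp h)

lemma sum_adjugate_vander (d : ℕ) (k : Fin (d + 1)) {i : ℕ} (hi : i ≤ d) :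
    ∑ u : Fin (d + 1), (vander d).adjugate k u * ((u : ℕ) : ℤ) ^ i =
      if i = k then (vander d).det else 0 := by
  have := congr_fun (congr_fun (Matrix.adjugate_mul (vander d)) k) ⟨i, by omega⟩
  rw [Matrix.mul_apply] at this
  simp only [vander, Matrix.vandermonde_apply, Matrix.smul_apply, Matrix.one_apply,
    Fin.ext_iff] at this ⊢
  rw [this]
  by_cases h : i = k
  · simp [h]
  · simp [h, Ne.symm h]

lemma sum_adjugate_mul_coeff_mvLine {n d : ℕ} (x : Fin n → ℤ) (P : MvPolynomial (Fin n) ℤ)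
    (b : Fin n → ℕ) (hb : ∑ i, b i ≤ d) :
    ∑ v : Fin n → Fin (d + 1),
      (∏ i, (vander d).adjugate (Fin.ofNat (d + 1) (b i)) (v i)) *
        (mvLine x (fun i => ((v i : ℕ) : ℤ)) P).coeff (∑ i, b i) =
      (vander d).det ^ n * (mvShift x P).coeff (Finsupp.equivFunOnFinite.symm b) := by
  simp_rw [coeff_mvLine, Finset.mul_sum]
  rw [Finset.sum_comm]
  have hbd : ∀ i, ((Fin.ofNat (d + 1) (b i) : Fin (d + 1)) : ℕ) = b i := fun i =>
    Nat.mod_eq_of_lt (Nat.lt_succ_of_le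
      ((Finset.single_le_sum (fun i _ => Nat.zero_le (b i)) (Finset.mem_univ i)).trans hb))
  have key : ∀ m : Fin n →₀ ℕ, ∑ v : Fin n → Fin (d + 1),
      (∏ i, (vander d).adjugate (Fin.ofNat (d + 1) (b i)) (v i)) *
        (if ∑ i, m i = ∑ i, b i then
          (mvShift x P).coeff m * ∏ i, (((v i : ℕ) : ℤ)) ^ m i else 0) =
      if m = Finsupp.equivFunOnFinite.symm b then
        (vander d).det ^ n * (mvShift x P).coeff m else 0 := by
    intro m
    by_cases hm : ∑ i, m i = ∑ i, b i
    · have hmd : ∀ i, m i ≤ d := fun i =>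
        (Finset.single_le_sum (fun i _ => Nat.zero_le (m i)) (Finset.mem_univ i)).trans
          (hm.trans_le hb)
      simp only [hm, if_true]
      have e : ∀ v : Fin n → Fin (d + 1),
          (∏ i, (vander d).adjugate (Fin.ofNat (d + 1) (b i)) (v i)) *
            ((mvShift x P).coeff m * ∏ i, (((v i : ℕ) : ℤ)) ^ m i) =
          (mvShift x P).coeff m * ∏ i, ((vander d).adjugate (Fin.ofNat (d + 1) (b i)) (v i) *
            (((v i : ℕ) : ℤ)) ^ m i) := by
        intro v
        rw [Finset.prod_mul_distrib]
        ring
      simp_rw [e]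
      have hprod := Finset.prod_univ_sum (fun _ : Fin n => Finset.univ) fun i u =>
        (vander d).adjugate (Fin.ofNat (d + 1) (b i)) u * (((u : ℕ) : ℤ)) ^ m i
      rw [Fintype.piFinset_univ] at hprod
      rw [← Finset.mul_sum, ← hprod]
      simp_rw [sum_adjugate_vander d _ (hmd _), hbd]
      by_cases hmb : m = Finsupp.equivFunOnFinite.symm b
      · subst hmb
        simp [mul_comm]
      · rw [if_neg hmb]
        obtain ⟨i, hi⟩ : ∃ i, m i ≠ b i := by
          by_contra! h
          exact hmb (Finsupp.ext h)
        rw [Finset.prod_eq_zero (Finset.mem_univ i) (if_neg hi), mul_zero]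
    · have hmb : m ≠ Finsupp.equivFunOnFinite.symm b := by
        rintro rfl
        exact hm rfl
      simp [hm, hmb]
  rw [Finset.sum_congr rfl fun m _ => key m, Finset.sum_ite_eq']
  by_cases h : Finsupp.equivFunOnFinite.symm b ∈ (mvShift x P).support
  · rw [if_pos h]
  · rw [if_neg h, MvPolynomial.notMem_support_iff.mp h, mul_zero]

/-- Some direction in the grid `{0, …, d}^n` sees a given Taylor coefficient. -/
lemma exists_norm_coeff_mvShift_le (p : ℕ) [Fact p.Prime] {n d : ℕ} (x : Fin n → ℤ)
    (P : MvPolynomial (Fin n) ℤ) (b : Fin n → ℕ) (hb : ∑ i, b i ≤ d) :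
    ∃ v : Fin n → Fin (d + 1),
      ‖(((mvShift x P).coeff (Finsupp.equivFunOnFinite.symm b) : ℤ) : ℚ_[p])‖ ≤
        |((vander d).det : ℝ)| ^ n *
          ‖(((mvLine x (fun i => ((v i : ℕ) : ℤ)) P).coeff (∑ i, b i) : ℤ) : ℚ_[p])‖ := by
  have h := congr_arg (Int.cast : ℤ → ℚ_[p]) (sum_adjugate_mul_coeff_mvLine x P b hb)
  rw [Int.cast_sum] at h
  obtain ⟨v, -, hv⟩ := IsUltrametricDist.exists_norm_finsetSum_le
    (Finset.univ : Finset (Fin n → Fin (d + 1))) fun v =>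
      (((∏ i, (vander d).adjugate (Fin.ofNat (d + 1) (b i)) (v i)) *
        (mvLine x (fun i => ((v i : ℕ) : ℤ)) P).coeff (∑ i, b i) : ℤ) : ℚ_[p])
  refine ⟨v, ?_⟩
  rw [h, Int.cast_mul, Int.cast_mul, norm_mul, norm_mul, Int.cast_pow, norm_pow] at hv
  have h1 := one_le_norm_intCast_mul_abs p (det_vander_ne_zero d)
  have h2 := Padic.norm_int_le_one (p := p)
    (∏ i, (vander d).adjugate (Fin.ofNat (d + 1) (b i)) (v i))
  set c := ‖(((mvShift x P).coeff (Finsupp.equivFunOnFinite.symm b) : ℤ) : ℚ_[p])‖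
  calc c ≤ (‖((vander d).det : ℚ_[p])‖ * |((vander d).det : ℝ)|) ^ n * c :=
        le_mul_of_one_le_left (norm_nonneg _) (one_le_pow₀ h1)
    _ = |((vander d).det : ℝ)| ^ n * (‖((vander d).det : ℚ_[p])‖ ^ n * c) := by
        rw [mul_pow]; ring
    _ ≤ |((vander d).det : ℝ)| ^ n * (1 *
        ‖(((mvLine x (fun i => ((v i : ℕ) : ℤ)) P).coeff (∑ i, b i) : ℤ) : ℚ_[p])‖) := by
        refine mul_le_mul_of_nonneg_left ?_ (by positivity)
        exact hv.trans (by gcongr)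
    _ = _ := by rw [one_mul]

lemma mvShift_pderiv {σ R : Type*} [CommRing R] (x : σ → R) (i : σ) (P : MvPolynomial σ R) :
    mvShift x (MvPolynomial.pderiv i P) = MvPolynomial.pderiv i (mvShift x P) := by
  classical
  induction P using MvPolynomial.induction_on with
  | C a => simp [mvShift]
  | add P Q hP hQ => simp [hP, hQ]
  | mul_X P j hP =>
    simp only [MvPolynomial.pderiv_mul, map_add, map_mul, hP]
    have : mvShift x (MvPolynomial.X j) = MvPolynomial.X j + MvPolynomial.C (x j) := by
      simp [mvShift]
    rw [this]
    by_cases h : j = i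
    · subst h
      simp
    · simp [MvPolynomial.pderiv_X_of_ne h]

lemma coeff_zero_mvShift {σ R : Type*} [CommRing R] (x : σ → R) (P : MvPolynomial σ R) :
    (mvShift x P).coeff 0 = MvPolynomial.eval x P := by
  have : ((MvPolynomial.aeval (0 : σ → R)).comp (mvShift x)) = MvPolynomial.aeval x := by
    ext1 i
    simp [mvShift]
  have h := DFunLike.congr_fun this P
  rw [← MvPolynomial.constantCoeff_eq]
  simpa [MvPolynomial.aeval_eq_eval, MvPolynomial.aeval_zero] using h

lemma coeff_iterate_pderiv {σ R : Type*} [CommRing R] (i : σ) (k : ℕ) (P : MvPolynomial σ R)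
    (m : σ →₀ ℕ) (hm : m i = 0) : ((⇑(MvPolynomial.pderiv i))^[k] P).coeff m =
      k.factorial * P.coeff (m + Finsupp.single i k) := by
  induction k generalizing P with
  | zero => simp
  | succ k ih =>
    rw [Function.iterate_succ_apply, ih, MvPolynomial.coeff_pderiv, add_assoc,
      ← Finsupp.single_add, Nat.factorial_succ]
    simp [hm]
    ring

lemma coeff_foldl_pderiv {σ R : Type*} [CommRing R] (β : σ → ℕ) (l : List σ) (hl : l.Nodup)
    (P : MvPolynomial σ R) (m : σ →₀ ℕ) (hm : ∀ i ∈ l, m i = 0) :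
    (l.foldl (fun Q i => (⇑(MvPolynomial.pderiv i))^[β i] Q) P).coeff m =
      (l.map fun i => ((β i).factorial : R)).prod *
        P.coeff (m + (l.map fun i => Finsupp.single i (β i)).sum) := by
  classical
  induction l generalizing P with
  | nil => simp
  | cons i l ih =>
    have hil := (List.nodup_cons.mp hl).1
    replace hl := (List.nodup_cons.mp hl).2
    rw [List.foldl_cons, ih hl _ fun j hj => hm j (List.mem_cons_of_mem i hj),
      coeff_iterate_pderiv]
    · simp only [List.map_cons, List.prod_cons, List.sum_cons]
      rw [add_assoc, add_comm (List.sum _)]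
      ring
    · rw [Finsupp.add_apply, hm i (List.mem_cons_self), zero_add]
      clear ih hm hl
      induction l with
      | nil => simp
      | cons j l ih =>
        obtain ⟨h1, h2⟩ := not_or.mp (mt List.mem_cons.mpr hil)
        simp [ih h2, Ne.symm h1]

lemma eval_mvDeriv {p : ℕ} [Fact p.Prime] {n : ℕ} (β : Fin n → ℕ)
    (P : MvPolynomial (Fin n) ℚ_[p]) (x : Fin n → ℚ_[p]) :
    MvPolynomial.eval x (mvDeriv β P) = ((∏ i, (β i).factorial : ℕ) : ℚ_[p]) *
      (mvShift x P).coeff (Finsupp.equivFunOnFinite.symm β) := by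
  have hcomm : ∀ (l : List (Fin n)) (P : MvPolynomial (Fin n) ℚ_[p]),
      mvShift x (l.foldl (fun Q i => (⇑(MvPolynomial.pderiv i))^[β i] Q) P) =
        l.foldl (fun Q i => (⇑(MvPolynomial.pderiv i))^[β i] Q) (mvShift x P) := by
    intro l
    induction l with
    | nil => simp
    | cons i l ih =>
      intro P
      rw [List.foldl_cons, ih, List.foldl_cons]
      congr 1
      exact Function.Semiconj.iterate_right (mvShift_pderiv x i) (β i) P
  rw [← coeff_zero_mvShift, mvDeriv, hcomm,
    coeff_foldl_pderiv β _ (List.nodup_finRange n) _ 0 (by simp), zero_add]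
  congr 2
  · rw [← List.ofFn_eq_map, List.prod_ofFn]
    simp
  · rw [← List.ofFn_eq_map, List.sum_ofFn]
    ext j
    simp [Finsupp.finsetSum_apply, Finsupp.single_apply]

/-- Fubini along the direction `v` for a sublevel set on which a directional Taylor coefficient
is large. -/
lemma card_directional_sublevel_le (p : ℕ) [Fact p.Prime] {n d q : ℕ} (hq : 0 < q) {K : ℝ}
    (hK : 0 < K) (Q : MvPolynomial (Fin n) ℤ) (hQ : Q.totalDegree ≤ d) (a : ℤ)
    (v : Fin n → Fin (d + 1)) (S : Finset (Fin n → ℕ))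
    (hS : ∀ x ∈ S, ∀ i, x i < q)
    (hv : ∀ x ∈ S, ‖((MvPolynomial.eval (fun i => (x i : ℤ)) Q - a : ℤ) : ℚ_[p])‖ * q ≤ 1)
    (hc : ∀ x ∈ S, ∃ j, 1 ≤ j ∧ K ^ j ≤
      ‖(((mvLine (fun i => (x i : ℤ)) (fun i => ((v i : ℕ) : ℤ)) Q).coeff j : ℤ) : ℚ_[p])‖ * q) :
    (S.card : ℝ) ≤ ((d + 1) * q) ^ n * (2 * d) / K := by
  classical
  let w : Fin n → ℤ := fun i => ((v i : ℕ) : ℤ)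
  let Y : Finset (Fin n → ℤ) := Fintype.piFinset fun _ => Finset.Ico (-((d * q : ℕ) : ℤ)) q
  let f : (Fin n → ℕ) × ℕ → Fin n → ℤ := fun z i => (z.1 i : ℤ) - z.2 * w i
  have hY : (Y.card : ℝ) = ((d + 1) * q) ^ n := by
    have : ((q : ℤ) - -((d * q : ℕ) : ℤ)).toNat = (d + 1) * q := by
      rw [show (q : ℤ) - -((d * q : ℕ) : ℤ) = (((d + 1) * q : ℕ) : ℤ) by push_cast; ring,
        Int.toNat_natCast]
    simp only [Y, Fintype.card_piFinset, Int.card_Ico, this, Finset.prod_const, Finset.card_univ,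
      Fintype.card_fin]
    push_cast
    rfl
  have hmaps : Set.MapsTo f (S ×ˢ Finset.range q : Finset _) Y := by
    rintro ⟨x, t⟩ hz
    obtain ⟨hx, ht⟩ := Finset.mem_product.mp (Finset.mem_coe.mp hz)
    simp only [Y, Finset.mem_coe, Fintype.mem_piFinset, Finset.mem_Ico, f, w]
    intro i
    have h1 := hS x hx i
    have h2 := Finset.mem_range.mp ht
    simp only at h1 h2
    have h3 : t * (v i : ℕ) ≤ d * q := by
      rw [mul_comm]
      exact Nat.mul_le_mul (Nat.lt_succ_iff.mp (v i).2) h2.le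
    zify at h1 h3
    push_cast
    constructor
    · linarith [Int.natCast_nonneg (x i)]
    · have : (0 : ℤ) ≤ t * (v i : ℕ) := by positivity
      linarith
  have hfib : ∀ y ∈ Y, (((S ×ˢ Finset.range q).filter fun z => f z = y).card : ℝ) ≤
      d * (2 * q / K) := by
    intro y _
    set F := (S ×ˢ Finset.range q).filter fun z => f z = y with hF
    have hinj : Set.InjOn Prod.snd (F : Set ((Fin n → ℕ) × ℕ)) := by
      rintro ⟨x, t⟩ hz ⟨x', t'⟩ hz' h
      simp only at h
      subst h
      have e := (Finset.mem_filter.mp (Finset.mem_coe.mp hz)).2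
      have e' := (Finset.mem_filter.mp (Finset.mem_coe.mp hz')).2
      refine Prod.ext (funext fun i => ?_) rfl
      have := congr_fun (e.trans e'.symm) i
      simp only [f, sub_left_inj] at this
      exact_mod_cast this
    rw [← Finset.card_image_of_injOn hinj]
    have hmem : ∀ t ∈ F.image Prod.snd, t < q ∧ ∃ x ∈ S,
        (fun i => (x i : ℤ)) = fun i => y i + t * w i := by
      intro t ht
      obtain ⟨⟨x, t'⟩, hz, rfl⟩ := Finset.mem_image.mp ht
      obtain ⟨hz', rfl⟩ := Finset.mem_filter.mp hz
      obtain ⟨hx, ht⟩ := Finset.mem_product.mp hz'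
      exact ⟨Finset.mem_range.mp ht, x, hx, by simp [f]⟩
    refine card_sublevel_le p q d hK (mvLine y w Q) (natDegree_mvLine_le _ _ _ hQ) a _ ?_ ?_ ?_
    · exact fun t ht => Finset.mem_range.mpr (hmem t ht).1
    · intro t ht
      obtain ⟨-, x, hx, e⟩ := hmem t ht
      rw [eval_mvLine, ← e]
      exact hv x hx
    · intro t ht
      obtain ⟨-, x, hx, e⟩ := hmem t ht
      rw [taylor_mvLine, ← e]
      exact hc x hx
  have hq' : 0 < (q : ℝ) := by exact_mod_cast hq
  have htot : (S.card : ℝ) * q ≤ ((d + 1) * q) ^ n * (d * (2 * q / K)) := by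
    calc (S.card : ℝ) * q = ((S ×ˢ Finset.range q).card : ℝ) := by
          rw [Finset.card_product, Finset.card_range, Nat.cast_mul]
      _ = ∑ y ∈ Y, (((S ×ˢ Finset.range q).filter fun z => f z = y).card : ℝ) := by
          rw [Finset.card_eq_sum_card_fiberwise hmaps, Nat.cast_sum]
      _ ≤ ∑ y ∈ Y, d * (2 * q / K) := Finset.sum_le_sum hfib
      _ = _ := by rw [Finset.sum_const, nsmul_eq_mul, hY]
  refine le_of_mul_le_mul_right (htot.trans_eq ?_) hq'
  ring

lemma totalDegree_mvScaled_le (p : ℕ) [Fact p.Prime] {n : ℕ} (α : ℕ)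
    (Q : MvPolynomial (Fin n) ℤ) : (mvScaled p α Q).totalDegree ≤ Q.totalDegree := by
  have hmap : (MvPolynomial.map (Int.castRingHom ℚ_[p]) Q).totalDegree ≤ Q.totalDegree :=
    Finset.sup_mono (MvPolynomial.support_map_subset _ _)
  refine (MvPolynomial.totalDegree_mul _ _).trans ?_
  rwa [MvPolynomial.totalDegree_C, zero_add]

lemma coeff_mvShift_mvScaled (p : ℕ) [Fact p.Prime] {n : ℕ} (α : ℕ)
    (Q : MvPolynomial (Fin n) ℤ) (x : Fin n → ℤ) (m : Fin n →₀ ℕ) :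
    (mvShift (fun i => (x i : ℚ_[p])) (mvScaled p α Q)).coeff m =
      ((p : ℚ_[p]) ^ α)⁻¹ * ((mvShift x Q).coeff m : ℤ) := by
  have h : mvShift (fun i => (x i : ℚ_[p])) (MvPolynomial.map (Int.castRingHom ℚ_[p]) Q) =
      MvPolynomial.map (Int.castRingHom ℚ_[p]) (mvShift x Q) := by
    induction Q using MvPolynomial.induction_on with
    | C a => simp [mvShift]
    | add P Q hP hQ => simp [hP, hQ]
    | mul_X P j hP =>
      simp only [map_mul, hP]
      simp [mvShift]
  rw [mvScaled, ← MvPolynomial.smul_eq_C_mul, map_smul, h, MvPolynomial.coeff_smul,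
    MvPolynomial.coeff_map]
  rfl

lemma norm_inv_prime_pow_mul (p : ℕ) [Fact p.Prime] (α : ℕ) (z : ℚ_[p]) :
    ‖((p : ℚ_[p]) ^ α)⁻¹ * z‖ = ‖z‖ * ((p ^ α : ℕ) : ℝ) := by
  simp [mul_comm]

/-- At every integer point some Taylor coefficient of `Q` is large in terms of `H_P`,
`P = p^{-α} Q`. -/
lemma exists_HinfMv_pow_le (p : ℕ) [Fact p.Prime] {n : ℕ} (α : ℕ) (Q : MvPolynomial (Fin n) ℤ)
    (hH : 0 < HinfMv (mvScaled p α Q)) (x : Fin n → ℤ) :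
    ∃ b : Fin n → ℕ, 1 ≤ ∑ i, b i ∧ ∑ i, b i ≤ Q.totalDegree ∧
      (HinfMv (mvScaled p α Q) : ℝ) ^ (∑ i, b i) ≤
        ‖(((mvShift x Q).coeff (Finsupp.equivFunOnFinite.symm b) : ℤ) : ℚ_[p])‖ *
          ((p ^ α : ℕ) : ℝ) := by
  have hle : HinfMv (mvScaled p α Q) ≤ HfunMv (mvScaled p α Q) (fun i => (x i : ℤ_[p])) :=
    ciInf_le (OrderBot.bddBelow _) _
  obtain ⟨b, -, hb⟩ := Finset.exists_mem_eq_sup Finset.univ Finset.univ_nonempty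
    (fun b : Fin n → Fin ((mvScaled p α Q).totalDegree + 1) =>
      if 1 ≤ ∑ i, (b i : ℕ) ∧ ∑ i, (b i : ℕ) ≤ (mvScaled p α Q).totalDegree then
        ‖MvPolynomial.eval (fun i => (((x i : ℤ_[p]) : ℚ_[p])))
            (mvDeriv (fun i => (b i : ℕ)) (mvScaled p α Q)) /
            ((∏ i, Nat.factorial (b i) : ℕ) : ℚ_[p])‖₊ ^ ((1 : ℝ) / ((∑ i, (b i : ℕ) : ℕ) : ℝ))
      else 0)
  rw [HfunMv, hb] at hle
  split_ifs at hle with h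
  · refine ⟨fun i => b i, h.1, h.2.trans (totalDegree_mvScaled_le p α Q), ?_⟩
    rw [← norm_inv_prime_pow_mul, ← coeff_mvShift_mvScaled]
    have hfac : ((∏ i, Nat.factorial (b i) : ℕ) : ℚ_[p]) ≠ 0 := by
      exact_mod_cast Finset.prod_ne_zero_iff.mpr fun i _ => Nat.factorial_ne_zero _
    have hx : (fun i => (((x i : ℤ_[p]) : ℚ_[p]))) = fun i => (x i : ℚ_[p]) := by
      funext i
      simp
    rw [hx, eval_mvDeriv, mul_div_cancel_left₀ _ hfac, one_div,
      NNReal.le_rpow_inv_iff (by exact_mod_cast h.1), NNReal.rpow_natCast] at hle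
    exact_mod_cast hle
  · exact absurd hle (not_le.mpr hH)

/-- Congruence-count bound (Proposition 1.6, upper bound): for `d, n ≥ 1` there is
`C_{d,n} > 0` such that for every prime `p`, every `Q ∈ ℤ[X₁,…,Xₙ]` of degree at most `d`,
every `α ≥ 1` and every integer `a`,
`max(1, H_{p^{-α}Q}) · p^{-nα} · N_{a,α} ≤ C_{d,n}`, where `N_{a,α}` is the number of
`x ∈ {0,…,p^α-1}^n` with `Q(x) ≡ a (mod p^α)`. -/
theorem congruence_count_bound (d n : ℕ) (hd : 1 ≤ d) (hn : 1 ≤ n) :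
    ∃ C : ℝ, 0 < C ∧
      ∀ (p : ℕ) [Fact p.Prime],
        ∀ Q : MvPolynomial (Fin n) ℤ, Q.totalDegree ≤ d →
          ∀ α : ℕ, 1 ≤ α → ∀ a : ℤ,
            max 1 (HinfMv (mvScaled p α Q) : ℝ) * (((p : ℝ) ^ (n * α))⁻¹ *
              (((Fintype.piFinset fun _ : Fin n => Finset.range (p ^ α)).filter fun x =>
                  ((p : ℤ) ^ α ∣ MvPolynomial.eval (fun i => ((x i : ℤ))) Q - a)).card : ℝ)) ≤
              C := by
  classical
  set D : ℝ := |((vander d).det : ℝ)| ^ n with hD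
  have hD1 : 1 ≤ D := by
    refine one_le_pow₀ ?_
    exact_mod_cast Int.one_le_abs (det_vander_ne_zero d)
  refine ⟨max 1 (((d : ℝ) + 1) ^ n * (((d + 1) ^ n) * (2 * d) * D)), by positivity, ?_⟩
  intro p _ Q hQ α _ a
  set S := (Fintype.piFinset fun _ : Fin n => Finset.range (p ^ α)).filter fun x =>
    ((p : ℤ) ^ α ∣ MvPolynomial.eval (fun i => ((x i : ℤ))) Q - a) with hS
  set q : ℕ := p ^ α with hq
  set H : ℝ := (HinfMv (mvScaled p α Q) : ℝ) with hH
  have hq0 : 0 < q := pow_pos (Fact.out : p.Prime).pos α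
  have hq0' : 0 < (q : ℝ) := by exact_mod_cast hq0
  have hqn : (p : ℝ) ^ (n * α) = (q : ℝ) ^ n := by
    rw [hq, mul_comm, pow_mul, Nat.cast_pow]
  have hSq : ∀ x ∈ S, ∀ i, x i < q := fun x hx i =>
    Finset.mem_range.mp (Fintype.mem_piFinset.mp (Finset.mem_filter.mp hx).1 i)
  have htriv : (S.card : ℝ) ≤ (q : ℝ) ^ n := by
    have := Finset.card_filter_le (Fintype.piFinset fun _ : Fin n => Finset.range (p ^ α))
      fun x => ((p : ℤ) ^ α ∣ MvPolynomial.eval (fun i => ((x i : ℤ))) Q - a)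
    rw [Fintype.card_piFinset, Finset.prod_const, Finset.card_range, Finset.card_univ,
      Fintype.card_fin] at this
    exact_mod_cast this
  have hmain : H * S.card ≤
      ((d : ℝ) + 1) ^ n * (((d + 1) ^ n) * (2 * d) * D) * (q : ℝ) ^ n := by
    rcases (NNReal.coe_nonneg (HinfMv (mvScaled p α Q))).eq_or_lt with h0 | hpos
    · rw [hH, ← h0, zero_mul]
      positivity
    have hK : 0 < H / D := by positivity
    let Sv : (Fin n → Fin (d + 1)) → Finset (Fin n → ℕ) := fun v => S.filter fun x =>
      ∃ j, 1 ≤ j ∧ (H / D) ^ j ≤ ‖(((mvLine (fun i => (x i : ℤ))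
        (fun i => ((v i : ℕ) : ℤ)) Q).coeff j : ℤ) : ℚ_[p])‖ * q
    have hcover : S ⊆ Finset.univ.biUnion Sv := by
      intro x hx
      obtain ⟨b, hb1, hbd, hb⟩ := exists_HinfMv_pow_le p α Q (by exact_mod_cast hpos)
        (fun i => (x i : ℤ))
      obtain ⟨v, hv⟩ := exists_norm_coeff_mvShift_le p (fun i => (x i : ℤ)) Q b (hbd.trans hQ)
      refine Finset.mem_biUnion.mpr ⟨v, Finset.mem_univ _, Finset.mem_filter.mpr
        ⟨hx, _, hb1, ?_⟩⟩
      have hDj : D ≤ D ^ (∑ i, b i) := le_self_pow₀ hD1 (by omega)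
      rw [div_pow, div_le_iff₀ (by positivity)]
      calc H ^ (∑ i, b i) ≤ _ := hb
        _ ≤ _ := mul_le_mul_of_nonneg_right hv hq0'.le
        _ = ‖(((mvLine (fun i => (x i : ℤ)) (fun i => ((v i : ℕ) : ℤ)) Q).coeff
            (∑ i, b i) : ℤ) : ℚ_[p])‖ * q * D := by ring
        _ ≤ _ := by gcongr
    have hSv : ∀ v, ((Sv v).card : ℝ) ≤ ((d + 1) * q) ^ n * (2 * d) / (H / D) := by
      intro v
      refine card_directional_sublevel_le p hq0 hK Q hQ a v (Sv v)
        (fun x hx => hSq x (Finset.mem_filter.mp hx).1) (fun x hx => ?_)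
        (fun x hx => (Finset.mem_filter.mp hx).2)
      have hdvd := (Finset.mem_filter.mp (Finset.mem_filter.mp hx).1).2
      have := (Padic.norm_int_le_pow_iff_dvd (p := p) _ α).mpr (by exact_mod_cast hdvd)
      rw [zpow_neg, zpow_natCast, ← Nat.cast_pow, ← hq] at this
      rwa [← le_div_iff₀ hq0', one_div]
    have hcard : (S.card : ℝ) ≤ (d + 1) ^ n * (((d + 1) * q) ^ n * (2 * d) / (H / D)) := by
      calc (S.card : ℝ) ≤ ((Finset.univ.biUnion Sv).card : ℝ) := by
            exact_mod_cast Finset.card_le_card hcover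
        _ ≤ ∑ v, ((Sv v).card : ℝ) := by exact_mod_cast Finset.card_biUnion_le
        _ ≤ ∑ _v : Fin n → Fin (d + 1), ((d + 1) * q) ^ n * (2 * d) / (H / D) :=
            Finset.sum_le_sum fun v _ => hSv v
        _ = _ := by simp
    calc H * S.card ≤ H * _ := mul_le_mul_of_nonneg_left hcard hpos.le
      _ = _ := by
        have : H ≠ 0 := hpos.ne'
        field_simp
        rw [mul_pow]
  rw [hqn, ← mul_assoc, mul_comm (max 1 H), mul_assoc, inv_mul_le_iff₀ (by positivity),
    max_mul_of_nonneg _ _ (Nat.cast_nonneg _), mul_comm (_ ^ n),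
    max_mul_of_nonneg _ _ (by positivity)]
  exact max_le_max (by simpa using htriv) hmain
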